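/- Fix d ≥ 1. For all sufficiently large n the following holds. Suppose the degree-d polynomial f(x) = Σ_{multisets S ⊆ [2n], |S| ≤ d} c_S ∏_{i∈S} x_i has weight(f) = 1 and passes the dictator test T_d with probability at least 1/2 + β, where β = 1/log n. Then: (i) for every multiset S ⊆ [n] with |S| ≥ 2, |c_S| ≤ n^{−10d}; (ii) for every multiset S ⊆ [n+1,2n] that is not of the form {n+i : d} for some i ∈ [n], |c_S| ≤ n^{−10d}; (iii) for every i ∈ [n], |c_{{i}} + c_{{n+i:d}}| ≤ n^{−10d}; (iv) for every multiset S with S ∩ [n] ≠ ∅ and S ∩ [n+1,2n] ≠ ∅, |c_S| ≤ n^{−10d}. Consequently weight(f_{12}) ≤ 1/n, |weight(f_1) − weight(f_2)| ≤ 1/n, and 0.49 ≤ weight(f_1), weight(f_2) ≤ 0.51. -/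

import Mathlib

open MeasureTheory ProbabilityTheory Real
open scoped ENNReal NNReal

/-- Evaluation of a polynomial given by its (finitely supported) coefficient
function on multisets of variable indices. -/
noncomputable def polyEval {ι : Type*} (c : Multiset ι →₀ ℝ) (x : ι → ℝ) : ℝ :=
  ∑ S ∈ c.support, c S * (S.map x).prod

/-- Bernoulli measure on `Bool` with `Pr[true] = p`. -/
noncomputable def bernoulliBool (p : ℝ) : Measure Bool :=
  ENNReal.ofReal p • Measure.dirac true + ENNReal.ofReal (1 - p) • Measure.dirac false

/-- Uniform measure on the signs `{-1, 1} ⊆ ℝ`. -/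
noncomputable def signUnif : Measure ℝ :=
  (2 : ℝ≥0∞)⁻¹ • Measure.dirac 1 + (2 : ℝ≥0∞)⁻¹ • Measure.dirac (-1)

/-- Product of `n` independent standard Gaussians. -/
noncomputable def stdGaussianPi (n : ℕ) : Measure (Fin n → ℝ) :=
  Measure.pi fun _ => gaussianReal 0 1

/-- The sample distribution of the dictator test `T_d`: `n` independent
Bernoulli(β) bits `a`, two vectors `h, g` of `n` i.i.d. standard Gaussians, and a
uniform random sign `b ∈ {-1, 1}`, where `β = 1 / log n`. -/
noncomputable def TdMeasure (n : ℕ) :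
    Measure ((Fin n → Bool) × (Fin n → ℝ) × (Fin n → ℝ) × ℝ) :=
  (Measure.pi fun _ : Fin n => bernoulliBool (1 / Real.log n)).prod
    ((stdGaussianPi n).prod ((stdGaussianPi n).prod signUnif))

/-- The query point `y ∈ ℝ^{2n}` of the dictator test `T_d`: coordinates are
indexed by `Fin n ⊕ Fin n` (`Sum.inl i` is coordinate `i`, `Sum.inr i` is
coordinate `n + i`), with `y_i = a_i h_i + g_i ^ d + b δ` and `y_{n+i} = g_i`,
where `δ = 2 ^ (-n²)`. -/
noncomputable def TdPoint (d n : ℕ)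
    (ω : (Fin n → Bool) × (Fin n → ℝ) × (Fin n → ℝ) × ℝ) : Fin n ⊕ Fin n → ℝ :=
  Sum.elim
    (fun i => (if ω.1 i then ω.2.1 i else 0) + (ω.2.2.1 i) ^ d
      + ω.2.2.2 * (2 : ℝ) ^ (-((n : ℤ) ^ 2)))
    fun i => ω.2.2.1 i

/-- `weight(f) = Σ_{S ≠ ∅} |c_S|`. -/
noncomputable def weight {ι : Type*} [DecidableEq ι] (c : Multiset ι →₀ ℝ) : ℝ :=
  ∑ S ∈ c.support, if S = 0 then 0 else |c S|

/-- The weight of the restriction `f₁` of `f` to the first `n` variables. -/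
noncomputable def weightLeft {n : ℕ} (c : Multiset (Fin n ⊕ Fin n) →₀ ℝ) : ℝ :=
  ∑ S ∈ c.support, if S ≠ 0 ∧ ∀ x ∈ S, x.isLeft = true then |c S| else 0

/-- The weight of the restriction `f₂` of `f` to the last `n` variables. -/
noncomputable def weightRight {n : ℕ} (c : Multiset (Fin n ⊕ Fin n) →₀ ℝ) : ℝ :=
  ∑ S ∈ c.support, if S ≠ 0 ∧ ∀ x ∈ S, x.isRight = true then |c S| else 0

/-- The weight of the cross-term part `f₁₂` of `f`: the sum of `|c_S|` over
multisets `S` meeting both halves of the variables. -/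
noncomputable def weightCross {n : ℕ} (c : Multiset (Fin n ⊕ Fin n) →₀ ℝ) : ℝ :=
  ∑ S ∈ c.support,
    if (∃ x ∈ S, x.isLeft = true) ∧ ∃ x ∈ S, x.isRight = true then |c S| else 0

lemma gauss_small_ball (z τ : ℝ) (hτ : 0 ≤ τ) :
    gaussianReal 0 1 (Set.Icc (z - τ) (z + τ)) ≤ ENNReal.ofReal τ := by
  rw [gaussianReal_apply 0 one_ne_zero]
  have hpdf : ∀ x, gaussianPDF 0 1 x ≤ ENNReal.ofReal (1 / 2) := by
    intro x
    unfold gaussianPDF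
    apply ENNReal.ofReal_le_ofReal
    rw [gaussianPDFReal_def]
    have h1 : (2 : ℝ) ≤ √(2 * π * (1 : ℝ≥0)) := by
      apply Real.le_sqrt_of_sq_le
      have := Real.pi_gt_three
      push_cast
      nlinarith
    have h2 : (√(2 * π * (1 : ℝ≥0)))⁻¹ ≤ 1 / 2 := by
      rw [one_div]
      exact inv_anti₀ (by norm_num) h1
    have h3 : rexp (-(x - 0) ^ 2 / (2 * (1 : ℝ≥0))) ≤ 1 := by
      apply Real.exp_le_one_iff.mpr
      push_cast
      have := sq_nonneg (x - 0)
      linarith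
    have h4 := Real.exp_pos (-(x - 0) ^ 2 / (2 * (1 : ℝ≥0)))
    calc _ ≤ (1 / 2 : ℝ) * 1 := mul_le_mul h2 h3 h4.le (by norm_num)
      _ = 1 / 2 := by norm_num
  calc _ ≤ ∫⁻ x in Set.Icc (z - τ) (z + τ), ENNReal.ofReal (1 / 2) :=
        lintegral_mono fun x => hpdf x
    _ = ENNReal.ofReal τ := by
        rw [lintegral_const, Measure.restrict_apply_univ, Real.volume_Icc,
          ← ENNReal.ofReal_mul (by norm_num)]
        congr 1; ring

lemma gauss_tail (T : ℝ) (hT : 0 < T) :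
    gaussianReal 0 1 {x | T ≤ |x|} ≤ ENNReal.ofReal (1 / T ^ 2) := by
  have h := meas_ge_le_variance_div_sq (μ := gaussianReal 0 1) (X := id)
    (memLp_id_gaussianReal 2) hT
  rw [variance_id_gaussianReal] at h
  simpa using h

open Polynomial in
lemma univ_anti (p : ℝ[X]) (D k : ℕ) (η τ : ℝ) (hD : p.natDegree ≤ D) (hη : 0 < η)
    (hτ : 0 < τ) (hτ1 : τ ≤ 1) (hk : η ≤ |p.coeff k|) :
    gaussianReal 0 1 {t | |p.eval t| < η * (τ ^ 2 / 4) ^ D} ≤ ENNReal.ofReal ((D + 1) * τ) := by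
  classical
  set q : ℂ[X] := p.map (algebraMap ℝ ℂ) with hq
  have hqd : q.natDegree = p.natDegree := natDegree_map _
  have hM : η ≤ 2 ^ D * q.mahlerMeasure := by
    have h1 := norm_coeff_le_choose_mul_mahlerMeasure k q
    have h2 : ‖q.coeff k‖ = |p.coeff k| := by
      rw [hq, coeff_map]; simp
    have h3 : (q.natDegree.choose k : ℝ) ≤ 2 ^ D := by
      have : q.natDegree.choose k ≤ 2 ^ D :=
        (Nat.choose_le_two_pow _ _).trans (Nat.pow_le_pow_right (by norm_num) (hqd ▸ hD))
      exact_mod_cast this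
    calc η ≤ _ := hk
      _ = ‖q.coeff k‖ := h2.symm
      _ ≤ _ := h1
      _ ≤ _ := mul_le_mul_of_nonneg_right h3 (mahlerMeasure_nonneg _)
  have hsplit : q.Splits := IsAlgClosed.splits q
  have hcard : Multiset.card q.roots = q.natDegree := (splits_iff_card_roots.mp hsplit)
  have hsub : {t : ℝ | |p.eval t| < η * (τ ^ 2 / 4) ^ D} ⊆ {t | 1 / τ ≤ |t|} ∪
      ⋃ z ∈ q.roots.toFinset, Set.Icc (z.re - τ) (z.re + τ) := by
    intro t ht
    by_contra hcon
    simp only [Set.mem_union, Set.mem_ofPred_eq, not_or, not_le, Set.mem_iUnion, not_exists,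
      Multiset.mem_toFinset] at hcon ht
    obtain ⟨hT, hz⟩ := hcon
    have hroot : ∀ z ∈ q.roots, (τ ^ 2 / 2) * max 1 ‖z‖ ≤ ‖(t : ℂ) - z‖ := by
      intro z hzr
      have h1 := hz z hzr
      have h2 : τ ≤ ‖(t : ℂ) - z‖ := by
        refine le_trans ?_ (Complex.abs_re_le_norm _)
        simp only [Complex.sub_re, Complex.ofReal_re]
        by_contra h
        push Not at h
        rw [abs_lt] at h
        exact h1 ⟨by linarith [h.1], by linarith [h.2]⟩
      have h3 : ‖z‖ - |t| ≤ ‖(t : ℂ) - z‖ := by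
        have := norm_sub_norm_le z (t : ℂ)
        rw [norm_sub_rev z, Complex.norm_real, Real.norm_eq_abs] at this
        exact this
      have hTτ : τ * (1 / τ) = 1 := by field_simp
      have hT1 : 1 ≤ 1 / τ := by rw [le_div_iff₀ hτ]; linarith
      rcases le_total ‖z‖ (2 * (1 / τ)) with h | h
      · have : max 1 ‖z‖ ≤ 2 * (1 / τ) := max_le (by linarith) h
        calc _ ≤ (τ ^ 2 / 2) * (2 * (1 / τ)) := by gcongr
          _ = τ := by field_simp
          _ ≤ _ := h2
      · have : max 1 ‖z‖ = ‖z‖ := max_eq_right (by linarith)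
        rw [this]
        have h5 : τ ^ 2 ≤ 1 := by nlinarith
        nlinarith [norm_nonneg z]
    have hev : |p.eval t| = ‖q.leadingCoeff‖ * (q.roots.map fun z => ‖(t : ℂ) - z‖).prod := by
      have h1 : q.eval (t : ℂ) = ((p.eval t : ℝ) : ℂ) := by
        rw [hq]
        exact (eval_map_apply (algebraMap ℝ ℂ) t)
      have h2 : ‖q.eval (t : ℂ)‖ = |p.eval t| := by rw [h1, Complex.norm_real, Real.norm_eq_abs]
      rw [← h2]
      conv_lhs => rw [hsplit.eq_prod_roots]
      rw [eval_mul, eval_C, norm_mul, eval_multiset_prod, Multiset.map_map]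
      congr 1
      have h3 := map_multiset_prod (normHom : ℂ →*₀ ℝ)
        (q.roots.map ((fun f => eval (t : ℂ) f) ∘ fun a => X - C a))
      rw [Multiset.map_map] at h3
      refine h3.trans ?_
      congr 1
      apply Multiset.map_congr rfl
      intro z _
      simp [normHom]
    have hlow : (τ ^ 2 / 2) ^ D * q.mahlerMeasure ≤ |p.eval t| := by
      rw [hev, mahlerMeasure_eq_leadingCoeff_mul_prod_roots]
      have h1 : (q.roots.map fun z => (τ ^ 2 / 2) * max 1 ‖z‖).prod ≤
          (q.roots.map fun z => ‖(t : ℂ) - z‖).prod :=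
        Multiset.prod_map_le_prod_map₀ _ _ (fun z _ => by positivity) hroot
      rw [Multiset.prod_map_mul, Multiset.map_const', Multiset.prod_replicate, hcard] at h1
      have h2 : (τ ^ 2 / 2) ^ D ≤ (τ ^ 2 / 2) ^ q.natDegree :=
        pow_le_pow_of_le_one (by positivity) (by nlinarith) (hqd ▸ hD)
      have h3 : 0 ≤ (q.roots.map fun z => max 1 ‖z‖).prod := by
        apply Multiset.prod_nonneg
        intro a ha
        obtain ⟨z, _, rfl⟩ := Multiset.mem_map.mp ha
        positivity
      calc _ = ‖q.leadingCoeff‖ * ((τ ^ 2 / 2) ^ D * (q.roots.map fun z => max 1 ‖z‖).prod) := by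
            ring
        _ ≤ ‖q.leadingCoeff‖ * ((τ ^ 2 / 2) ^ q.natDegree *
              (q.roots.map fun z => max 1 ‖z‖).prod) := by gcongr
        _ ≤ _ := by gcongr
    have : η * (τ ^ 2 / 4) ^ D ≤ (τ ^ 2 / 2) ^ D * q.mahlerMeasure := by
      have e : (τ ^ 2 / 2) ^ D = (τ ^ 2 / 4) ^ D * 2 ^ D := by
        rw [← mul_pow]; congr 1; ring
      rw [e, mul_assoc, mul_comm]
      gcongr
    linarith
  refine (measure_mono hsub).trans ((measure_union_le _ _).trans ?_)
  have hA : gaussianReal 0 1 {t | 1 / τ ≤ |t|} ≤ ENNReal.ofReal τ := by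
    refine (gauss_tail _ (by positivity)).trans (ENNReal.ofReal_le_ofReal ?_)
    have : 1 / (1 / τ) ^ 2 = τ ^ 2 := by field_simp
    rw [this]; nlinarith
  have hB : gaussianReal 0 1 (⋃ z ∈ q.roots.toFinset, Set.Icc (z.re - τ) (z.re + τ)) ≤
      ENNReal.ofReal (D * τ) := by
    refine (measure_biUnion_finset_le _ _).trans ?_
    refine (Finset.sum_le_sum (fun z _ => gauss_small_ball z.re τ hτ.le)).trans ?_
    rw [Finset.sum_const, nsmul_eq_mul, ENNReal.ofReal_mul (by positivity), ENNReal.ofReal_natCast]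
    gcongr
    exact (Multiset.toFinset_card_le _).trans (by rw [hcard, hqd]; exact hD)
  refine (add_le_add hA hB).trans ?_
  rw [← ENNReal.ofReal_add hτ.le (by positivity)]
  apply ENNReal.ofReal_le_ofReal
  linarith

lemma prod_bound {α β : Type*} [MeasurableSpace α] [MeasurableSpace β] (μ : Measure α)
    (ν : Measure β) [IsProbabilityMeasure μ] [IsProbabilityMeasure ν] (s : Set (α × β))
    (hs : MeasurableSet s) (B : Set α) (p q : ℝ≥0∞) (hB : μ B ≤ p)
    (h : ∀ x ∉ B, ν (Prod.mk x ⁻¹' s) ≤ q) : μ.prod ν s ≤ p + q := by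
  rw [Measure.prod_apply hs]
  have h1 : ∀ x, ν (Prod.mk x ⁻¹' s) ≤ (toMeasurable μ B).indicator 1 x + q := by
    intro x
    by_cases hx : x ∈ toMeasurable μ B
    · rw [Set.indicator_of_mem hx]
      exact prob_le_one.trans le_self_add
    · exact (h x fun hb => hx (subset_toMeasurable _ _ hb)).trans le_add_self
  calc _ ≤ ∫⁻ x, ((toMeasurable μ B).indicator 1 x + q) ∂μ := lintegral_mono h1
    _ = μ B + q := by
      rw [lintegral_add_right _ measurable_const, lintegral_indicator_one
        (measurableSet_toMeasurable _ _), measure_toMeasurable]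
      simp
    _ ≤ p + q := by gcongr

instance stdGaussianPi_prob (n : ℕ) : IsProbabilityMeasure (stdGaussianPi n) := by
  unfold stdGaussianPi; infer_instance

lemma multi_anti (D : ℕ) (η τ : ℝ) (hη : 0 < η) (hτ : 0 < τ) (hτ1 : τ ≤ 1) :
    ∀ (n : ℕ) (P : MvPolynomial (Fin n) ℝ) (m : Fin n →₀ ℕ), (∀ j, P.degreeOf j ≤ D) →
      η ≤ |P.coeff m| →
      stdGaussianPi n {x | |MvPolynomial.eval x P| < η * ((τ ^ 2 / 4) ^ D) ^ n} ≤
        ENNReal.ofReal (n * ((D + 1) * τ)) := by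
  intro n
  induction n with
  | zero =>
    intro P m hP hm
    have : {x : Fin 0 → ℝ | |MvPolynomial.eval x P| < η * ((τ ^ 2 / 4) ^ D) ^ 0} = ∅ := by
      ext x
      simp only [pow_zero, mul_one, Set.mem_ofPred_eq, Set.mem_empty_iff_false, iff_false, not_lt]
      have hm0 : m = 0 := Subsingleton.elim _ _
      rw [hm0] at hm
      rw [MvPolynomial.eq_C_of_isEmpty P, MvPolynomial.eval_C]
      exact hm
    rw [this]; simp
  | succ n ih =>
    intro P m hP hm
    set Q := MvPolynomial.finSuccEquiv ℝ n P with hQ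
    have hmeas : MeasurableSet {x : Fin (n + 1) → ℝ | |MvPolynomial.eval x P| <
        η * ((τ ^ 2 / 4) ^ D) ^ (n + 1)} :=
      measurableSet_lt (MvPolynomial.continuous_eval P).measurable.abs measurable_const
    have hmp := measurePreserving_piFinSuccAbove (fun _ : Fin (n + 1) => gaussianReal 0 1) 0
    have hmp' := hmp.symm
    have hswap : MeasurePreserving (Prod.swap : (Fin n → ℝ) × ℝ → ℝ × (Fin n → ℝ))
      ((stdGaussianPi n).prod (gaussianReal 0 1)) ((gaussianReal 0 1).prod (stdGaussianPi n)) :=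
        Measure.measurePreserving_swap
    have hcomp := hmp'.comp hswap
    have e1 := hcomp.measure_preimage hmeas.nullMeasurableSet
    unfold stdGaussianPi at e1 ⊢
    rw [← e1]
    have hc : ∀ (x : Fin n → ℝ) (t : ℝ), (((MeasurableEquiv.piFinSuccAbove (fun _ => ℝ) 0).symm ∘
      Prod.swap) (x, t) : Fin (n + 1) → ℝ) = Fin.cons t x := by
      intro x t
      simp [MeasurableEquiv.piFinSuccAbove]
      rfl
    refine (prod_bound _ _ _ (hcomp.measurable hmeas)
      {x | |MvPolynomial.eval x (Q.coeff (m 0))| < η * ((τ ^ 2 / 4) ^ D) ^ n} _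
      (ENNReal.ofReal ((D + 1) * τ)) (ih (Q.coeff (m 0)) m.tail ?_ ?_) ?_).trans ?_
    · intro j
      exact (MvPolynomial.degreeOf_coeff_finSuccEquiv P j _).trans (hP _)
    · rw [hQ, MvPolynomial.finSuccEquiv_coeff_coeff, Finsupp.cons_tail]
      exact hm
    · intro x hx
      simp only [Set.mem_ofPred_eq, not_lt] at hx
      have := univ_anti (Q.map (MvPolynomial.eval x)) D (m 0) (η * ((τ ^ 2 / 4) ^ D) ^ n) τ
        (Polynomial.natDegree_map_le.trans
          (by rw [hQ, MvPolynomial.natDegree_finSuccEquiv]; exact hP 0)) (by positivity) hτ hτ1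
        (by rw [Polynomial.coeff_map]; exact hx)
      refine le_trans (measure_mono ?_) this
      intro t ht
      simp only [Set.mem_preimage, hc, Set.mem_ofPred_eq] at ht ⊢
      rw [MvPolynomial.eval_eq_eval_mv_eval'] at ht
      rw [mul_assoc, ← pow_succ]
      exact ht
    · rw [← ENNReal.ofReal_add (by positivity) (by positivity)]
      apply ENNReal.ofReal_le_ofReal
      push_cast
      linarith

/-- Substituting multivariate polynomials into the polynomial with coefficients `c`. -/
noncomputable def polyMv {ι : Type*} {n : ℕ} (φ : ι → MvPolynomial (Fin n) ℝ)
    (c : Multiset ι →₀ ℝ) : MvPolynomial (Fin n) ℝ :=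
  ∑ S ∈ c.support, MvPolynomial.C (c S) * (S.map φ).prod

lemma eval_polyMv {ι : Type*} {n : ℕ} (φ : ι → MvPolynomial (Fin n) ℝ)
    (c : Multiset ι →₀ ℝ) (x : Fin n → ℝ) :
    MvPolynomial.eval x (polyMv φ c) = polyEval c (fun s => MvPolynomial.eval x (φ s)) := by
  unfold polyMv polyEval
  rw [map_sum]
  refine Finset.sum_congr rfl fun S _ => ?_
  rw [map_mul, MvPolynomial.eval_C, map_multiset_prod, Multiset.map_map]
  rfl

lemma degreeOf_polyMv {ι : Type*} {n : ℕ} (φ : ι → MvPolynomial (Fin n) ℝ)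
    (c : Multiset ι →₀ ℝ) (d : ℕ) (hc : ∀ S ∈ c.support, Multiset.card S ≤ d)
    (hφ : ∀ s, (φ s).totalDegree ≤ d) (j : Fin n) : (polyMv φ c).degreeOf j ≤ d * d := by
  refine (MvPolynomial.degreeOf_le_totalDegree _ _).trans ?_
  unfold polyMv
  refine MvPolynomial.totalDegree_finsetSum_le fun S hS => ?_
  refine (MvPolynomial.totalDegree_mul _ _).trans ?_
  rw [MvPolynomial.totalDegree_C, zero_add]
  refine (MvPolynomial.totalDegree_multiset_prod _).trans ?_
  rw [Multiset.map_map]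
  refine (Multiset.sum_le_card_nsmul _ d ?_).trans ?_
  · intro x hx
    obtain ⟨s, _, rfl⟩ := Multiset.mem_map.mp hx
    exact hφ s
  · rw [Multiset.card_map, smul_eq_mul]
    exact Nat.mul_le_mul_right _ (hc S hS)

/-- exponent vector of the monomial obtained from `S` by `x_i ↦ g_i^d`, `x_{n+i} ↦ g_i`. -/
noncomputable def expo {n : ℕ} (d : ℕ) (S : Multiset (Fin n ⊕ Fin n)) : Fin n →₀ ℕ :=
  (S.map (Sum.elim (fun i => Finsupp.single i d) (fun i => Finsupp.single i 1))).sum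

lemma expo_apply {n : ℕ} (d : ℕ) (S : Multiset (Fin n ⊕ Fin n)) (i : Fin n) :
    expo d S i = d * S.count (Sum.inl i) + S.count (Sum.inr i) := by
  classical
  induction S using Multiset.induction_on with
  | empty => simp [expo]
  | cons s S ih =>
    have : expo d (s ::ₘ S) = (Sum.elim (fun i => Finsupp.single i d)
      (fun i => Finsupp.single i 1) s) + expo d S := by simp [expo]
    rw [this, Finsupp.add_apply, ih]
    rcases s with j | j
    · by_cases h : j = i
      · subst h
        simp; ring
      · have h' : i ≠ j := fun e => h e.symm
        simp [h, h', Multiset.count_cons]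
    · by_cases h : j = i
      · subst h
        simp; ring
      · have h' : i ≠ j := fun e => h e.symm
        simp [h, h', Multiset.count_cons]

lemma eq_replicate_of_count {α : Type*} [DecidableEq α] (S : Multiset α) (d : ℕ) (x : α)
    (hc : Multiset.card S ≤ d) (h : d ≤ S.count x) : S = Multiset.replicate d x := by
  symm
  apply Multiset.eq_of_le_of_card_le
  · exact Multiset.le_count_iff_replicate_le.mp h
  · simpa using hc

lemma expo_eq_single {n : ℕ} (d : ℕ) (hd : 1 ≤ d) (T : Multiset (Fin n ⊕ Fin n)) (i : Fin n)
    (h : expo d T = expo d (Multiset.replicate d (Sum.inr i))) :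
    T = Multiset.replicate d (Sum.inr i) ∨ T = {Sum.inl i} := by
  classical
  have hj : ∀ j, d * T.count (Sum.inl j) + T.count (Sum.inr j) = if j = i then d else 0 := by
    intro j
    rw [← expo_apply, h, expo_apply]
    simp only [Multiset.count_replicate]
    simp [eq_comm]
  have hi := hj i
  simp only [if_true] at hi
  have hne : ∀ j, j ≠ i → T.count (Sum.inl j) = 0 ∧ T.count (Sum.inr j) = 0 := by
    intro j hji
    have := hj j
    rw [if_neg hji] at this
    have h1 : d * T.count (Sum.inl j) = 0 := by omega
    refine ⟨?_, by omega⟩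
    rcases Nat.mul_eq_zero.mp h1 with h | h
    · omega
    · exact h
  rcases Nat.lt_or_ge (T.count (Sum.inl i)) 1 with h0 | h1
  · left
    have h0' : T.count (Sum.inl i) = 0 := by omega
    rw [h0'] at hi
    ext s
    rw [Multiset.count_replicate]
    rcases s with j | j
    · by_cases hji : j = i
      · subst hji; simp [h0']
      · simp [(hne j hji).1]
    · by_cases hji : j = i
      · subst hji; simp; omega
      · have : i ≠ j := fun e => hji e.symm
        simp [(hne j hji).2, this]
  · right
    have h2 : T.count (Sum.inl i) = 1 := by
      by_contra hcon
      have : 2 ≤ T.count (Sum.inl i) := by omega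
      nlinarith
    rw [h2] at hi
    ext s
    rw [Multiset.count_singleton]
    rcases s with j | j
    · by_cases hji : j = i
      · subst hji; simp [h2]
      · simp [(hne j hji).1, hji]
    · by_cases hji : j = i
      · subst hji; simp; simpa using hi
      · simp [(hne j hji).2]

lemma expo_inj {n : ℕ} (d : ℕ) (hd : 1 ≤ d) (S T : Multiset (Fin n ⊕ Fin n))
    (hS : Multiset.card S ≤ d) (hT : Multiset.card T ≤ d) (h : expo d S = expo d T) :
    S = T ∨ ∃ i, (S = Multiset.replicate d (Sum.inr i) ∧ T = {Sum.inl i}) ∨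
      (T = Multiset.replicate d (Sum.inr i) ∧ S = {Sum.inl i}) := by
  classical
  by_cases h1 : ∃ i, d ≤ S.count (Sum.inr i)
  · obtain ⟨i, hi⟩ := h1
    have e := eq_replicate_of_count S d _ hS hi
    rcases expo_eq_single d hd T i (by rw [← e, h]) with h2 | h2
    · left; rw [e, h2]
    · right; exact ⟨i, Or.inl ⟨e, h2⟩⟩
  by_cases h2 : ∃ i, d ≤ T.count (Sum.inr i)
  · obtain ⟨i, hi⟩ := h2
    have e := eq_replicate_of_count T d _ hT hi
    rcases expo_eq_single d hd S i (by rw [← e, h]) with h2 | h2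
    · left; rw [e, h2]
    · right; exact ⟨i, Or.inr ⟨e, h2⟩⟩
  left
  push Not at h1 h2
  have key : ∀ i, S.count (Sum.inl i) = T.count (Sum.inl i) ∧
      S.count (Sum.inr i) = T.count (Sum.inr i) := by
    intro i
    have e : d * S.count (Sum.inl i) + S.count (Sum.inr i) =
      d * T.count (Sum.inl i) + T.count (Sum.inr i) := by
      rw [← expo_apply, ← expo_apply, h]
    have e1 := congrArg (· % d) e
    have e2 := congrArg (· / d) e
    simp only [Nat.mul_add_mod, Nat.mod_eq_of_lt (h1 i), Nat.mod_eq_of_lt (h2 i)] at e1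
    simp only [Nat.mul_add_div (show d > 0 by omega), Nat.div_eq_of_lt (h1 i),
      Nat.div_eq_of_lt (h2 i)] at e2
    exact ⟨by omega, e1⟩
  ext s
  rcases s with i | i
  · exact (key i).1
  · exact (key i).2

/-- The substitution `x_i ↦ g_i^d`, `x_{n+i} ↦ g_i`. -/
noncomputable def phiG {n : ℕ} (d : ℕ) : Fin n ⊕ Fin n → MvPolynomial (Fin n) ℝ :=
  Sum.elim (fun i => MvPolynomial.X i ^ d) (fun i => MvPolynomial.X i)

lemma phiG_prod {n : ℕ} (d : ℕ) (S : Multiset (Fin n ⊕ Fin n)) :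
    (S.map (phiG d)).prod = MvPolynomial.monomial (expo d S) (1 : ℝ) := by
  induction S using Multiset.induction_on with
  | empty => simp [expo]
  | cons s S ih =>
    have : expo d (s ::ₘ S) = (Sum.elim (fun i => Finsupp.single i d)
      (fun i => Finsupp.single i 1) s) + expo d S := by simp [expo]
    rw [this, Multiset.map_cons, Multiset.prod_cons, ih]
    rcases s with j | j
    · simp [phiG, MvPolynomial.X_pow_eq_monomial, MvPolynomial.monomial_mul]
    · simp [phiG, MvPolynomial.X, MvPolynomial.monomial_mul]

lemma coeff_polyG {n : ℕ} (d : ℕ) (c : Multiset (Fin n ⊕ Fin n) →₀ ℝ) (m : Fin n →₀ ℕ) :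
    (polyMv (phiG d) c).coeff m = ∑ S ∈ c.support, if expo d S = m then c S else 0 := by
  unfold polyMv
  rw [MvPolynomial.coeff_sum]
  refine Finset.sum_congr rfl fun S _ => ?_
  rw [phiG_prod, MvPolynomial.coeff_C_mul, MvPolynomial.coeff_monomial]
  simp

lemma coeff_polyG_single {n : ℕ} (d : ℕ) (hd : 1 ≤ d) (c : Multiset (Fin n ⊕ Fin n) →₀ ℝ)
    (hc : ∀ S ∈ c.support, Multiset.card S ≤ d) (S : Multiset (Fin n ⊕ Fin n))
    (hS : Multiset.card S ≤ d) (h1 : ∀ i, S ≠ {Sum.inl i})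
    (h2 : ∀ i, S ≠ Multiset.replicate d (Sum.inr i)) :
    (polyMv (phiG d) c).coeff (expo d S) = c S := by
  classical
  rw [coeff_polyG]
  rw [Finset.sum_eq_single S]
  · simp
  · intro T hT hTS
    rw [if_neg]
    intro h
    rcases expo_inj d hd T S (hc T hT) hS h with h | ⟨i, h | h⟩
    · exact hTS h
    · exact h1 i h.2
    · exact h2 i h.1
  · intro h
    simpa using h

lemma coeff_polyG_pair {n : ℕ} (d : ℕ) (hd : 1 ≤ d) (c : Multiset (Fin n ⊕ Fin n) →₀ ℝ)
    (hc : ∀ S ∈ c.support, Multiset.card S ≤ d) (i : Fin n) :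
    (polyMv (phiG d) c).coeff (expo d {Sum.inl i}) =
      c {Sum.inl i} + c (Multiset.replicate d (Sum.inr i)) := by
  classical
  rw [coeff_polyG]
  have hexp : expo d (Multiset.replicate d (Sum.inr i)) = expo d {Sum.inl i} := by
    simp [expo]
  have hne : ({Sum.inl i} : Multiset (Fin n ⊕ Fin n)) ≠ Multiset.replicate d (Sum.inr i) := by
    intro h
    have : Sum.inl i ∈ Multiset.replicate d (Sum.inr i : Fin n ⊕ Fin n) := by rw [← h]; simp
    have := Multiset.eq_of_mem_replicate this
    simp at this
  rw [Finset.sum_eq_add {Sum.inl i} (Multiset.replicate d (Sum.inr i)) hne]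
  · simp [hexp]
  · intro T hT hTS
    rw [if_neg]
    intro h
    rcases expo_eq_single d hd T i (by rw [h, hexp]) with h | h
    · exact hTS.2 h
    · exact hTS.1 h
  · intro h
    simpa using h
  · intro h
    simp only [hexp, if_true]
    simpa using h

lemma prod_perturb {ι : Type*} (x y : ι → ℝ) (δ K : ℝ) (hδ : 0 ≤ δ) (hK : 1 ≤ K)
    (hx : ∀ i, |x i| ≤ K) (hy : ∀ i, |y i| ≤ K) (hxy : ∀ i, |x i - y i| ≤ δ)
    (S : Multiset ι) : |(S.map x).prod| ≤ K ^ Multiset.card S ∧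
      |(S.map x).prod - (S.map y).prod| ≤ Multiset.card S * δ * K ^ Multiset.card S := by
  induction S using Multiset.induction_on with
  | empty => simp
  | cons s S ih =>
    obtain ⟨ih1, ih2⟩ := ih
    simp only [Multiset.map_cons, Multiset.prod_cons, Multiset.card_cons]
    set A := (S.map x).prod
    set B := (S.map y).prod
    set k := Multiset.card S
    have hKk : 0 ≤ K ^ k := by positivity
    constructor
    · rw [abs_mul, pow_succ']
      exact mul_le_mul (hx s) ih1 (abs_nonneg _) (by linarith)
    · have e : x s * A - y s * B = (x s - y s) * A + y s * (A - B) := by ring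
      rw [e]
      refine (abs_add_le _ _).trans ?_
      rw [abs_mul, abs_mul]
      have h1 : |x s - y s| * |A| ≤ δ * K ^ k := mul_le_mul (hxy s) ih1 (abs_nonneg _) hδ
      have h2 : |y s| * |A - B| ≤ K * (k * δ * K ^ k) :=
        mul_le_mul (hy s) ih2 (abs_nonneg _) (by linarith)
      have h3 : δ * K ^ k ≤ δ * (K * K ^ k) := by
        apply mul_le_mul_of_nonneg_left _ hδ
        nlinarith
      rw [pow_succ']
      push_cast
      nlinarith

lemma poly_perturb {ι : Type*} [DecidableEq ι] (c : Multiset ι →₀ ℝ) (d : ℕ)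
    (hc : ∀ S ∈ c.support, Multiset.card S ≤ d) (hw : weight c = 1)
    (x y : ι → ℝ) (δ K : ℝ) (hδ : 0 ≤ δ) (hK : 1 ≤ K)
    (hx : ∀ i, |x i| ≤ K) (hy : ∀ i, |y i| ≤ K) (hxy : ∀ i, |x i - y i| ≤ δ) :
    |polyEval c x - polyEval c y| ≤ d * δ * K ^ d := by
  unfold polyEval
  rw [← Finset.sum_sub_distrib]
  refine (Finset.abs_sum_le_sum_abs _ _).trans ?_
  have : d * δ * K ^ d = ∑ S ∈ c.support, (if S = 0 then 0 else |c S|) * (d * δ * K ^ d) := by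
    rw [← Finset.sum_mul]
    unfold weight at hw
    rw [hw, one_mul]
  rw [this]
  refine Finset.sum_le_sum fun S hS => ?_
  by_cases h0 : S = 0
  · subst h0; simp
  · rw [if_neg h0, ← mul_sub, abs_mul]
    apply mul_le_mul_of_nonneg_left _ (abs_nonneg _)
    refine (prod_perturb x y δ K hδ hK hx hy hxy S).2.trans ?_
    have h1 : (Multiset.card S : ℝ) ≤ d := by exact_mod_cast hc S hS
    have h2 : K ^ Multiset.card S ≤ K ^ d := pow_le_pow_right₀ hK (hc S hS)
    gcongr

lemma exists_multiset_finset {ι : Type*} [Fintype ι] [DecidableEq ι] (k : ℕ) :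
    ∃ T : Finset (Multiset ι), (∀ S, Multiset.card S ≤ k → S ∈ T) ∧
      T.card ≤ (Fintype.card ι + 1) ^ k := by
  induction k with
  | zero => exact ⟨{0}, by simp, by simp⟩
  | succ k ih =>
    obtain ⟨T, hT, hcard⟩ := ih
    refine ⟨T ∪ (Finset.univ ×ˢ T).image (fun p => p.1 ::ₘ p.2), ?_, ?_⟩
    · intro S hS
      by_cases h : Multiset.card S ≤ k
      · exact Finset.mem_union_left _ (hT S h)
      · apply Finset.mem_union_right
        have hp : 0 < Multiset.card S := by omega
        obtain ⟨a, ha⟩ := Multiset.card_pos_iff_exists_mem.mp hp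
        obtain ⟨S', rfl⟩ := Multiset.exists_cons_of_mem ha
        rw [Finset.mem_image]
        refine ⟨(a, S'), ?_, rfl⟩
        simp only [Finset.mem_product, Finset.mem_univ, true_and]
        apply hT
        rw [Multiset.card_cons] at hS
        omega
    · refine (Finset.card_union_le _ _).trans ?_
      have h1 : ((Finset.univ ×ˢ T).image (fun p : ι × Multiset ι => p.1 ::ₘ p.2)).card ≤
          Fintype.card ι * T.card := by
        refine Finset.card_image_le.trans ?_
        rw [Finset.card_product, Finset.card_univ]
      rw [pow_succ]
      nlinarith

lemma card_support_le {ι : Type*} [Fintype ι] [DecidableEq ι] (c : Multiset ι →₀ ℝ) (d : ℕ)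
    (hc : ∀ S ∈ c.support, Multiset.card S ≤ d) :
    c.support.card ≤ (Fintype.card ι + 1) ^ d := by
  obtain ⟨T, hT, hcard⟩ := exists_multiset_finset (ι := ι) d
  exact (Finset.card_le_card fun S hS => hT S (hc S hS)).trans hcard

lemma sum_split_bound {ι : Type*} {n : ℕ} [DecidableEq ι] (c : Multiset ι →₀ ℝ)
    (p : Multiset ι → Prop) [DecidablePred p] (r : Fin n → Multiset ι)
    (hr : Function.Injective r) (hpr : ∀ i, p (r i)) (η : ℝ)
    (hs : ∀ S, p S → (∀ i, S ≠ r i) → |c S| ≤ η) (hη : 0 ≤ η) :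
    ∑ i, |c (r i)| ≤ ∑ S ∈ c.support, (if p S then |c S| else 0) ∧
    ∑ S ∈ c.support, (if p S then |c S| else 0) ≤ ∑ i, |c (r i)| + c.support.card * η := by
  have e1 : ∑ i, |c (r i)| = ∑ S ∈ Finset.univ.image r, |c S| := by
    rw [Finset.sum_image (fun a _ b _ h => hr h)]
  have e2 : ∑ S ∈ Finset.univ.image r, |c S| = ∑ S ∈ c.support ∩ Finset.univ.image r, |c S| := by
    symm
    apply Finset.sum_subset Finset.inter_subset_right
    intro S hS hS'
    have : S ∉ c.support := fun h => hS' (Finset.mem_inter.mpr ⟨h, hS⟩)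
    simpa using this
  rw [e1, e2, ← Finset.filter_mem_eq_inter, Finset.sum_filter]
  constructor
  · refine Finset.sum_le_sum fun S _ => ?_
    by_cases h : S ∈ Finset.univ.image r
    · rw [if_pos h]
      obtain ⟨i, _, rfl⟩ := Finset.mem_image.mp h
      rw [if_pos (hpr i)]
    · rw [if_neg h]
      split_ifs <;> positivity
  · rw [← nsmul_eq_mul, ← Finset.sum_const, ← Finset.sum_add_distrib]
    refine Finset.sum_le_sum fun S _ => ?_
    by_cases h : S ∈ Finset.univ.image r
    · rw [if_pos h]
      split_ifs
      · linarith
      · positivity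
    · rw [if_neg h]
      split_ifs with hp
      · rw [zero_add]
        apply hs S hp
        intro i e
        exact h (Finset.mem_image.mpr ⟨i, Finset.mem_univ _, e.symm⟩)
      · linarith

lemma bernoulliBool_prob (p : ℝ) (h0 : 0 ≤ p) (h1 : p ≤ 1) :
    IsProbabilityMeasure (bernoulliBool p) := by
  constructor
  unfold bernoulliBool
  simp only [Measure.coe_add, Measure.coe_smul, Pi.add_apply, Pi.smul_apply, measure_univ,
    smul_eq_mul, mul_one]
  rw [← ENNReal.ofReal_add h0 (by linarith)]
  simp

instance signUnif_prob : IsProbabilityMeasure signUnif := by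
  constructor
  unfold signUnif
  simp [ENNReal.inv_two_add_inv_two]

lemma signUnif_le (s : Set ℝ) (h : (1 : ℝ) ∉ s ∨ (-1 : ℝ) ∉ s) : signUnif s ≤ ENNReal.ofReal (1 / 2) := by
  have e : ENNReal.ofReal (1 / 2) = 2⁻¹ := by
    rw [one_div, ENNReal.ofReal_inv_of_pos (by norm_num)]; simp
  rw [e]
  rcases h with h | h
  · refine (measure_mono (Set.subset_compl_singleton_iff.mpr h)).trans ?_
    unfold signUnif
    simp only [Measure.coe_add, Measure.coe_smul, Pi.add_apply, Pi.smul_apply, smul_eq_mul]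
    rw [Measure.dirac_apply' _ (measurableSet_singleton _).compl,
      Measure.dirac_apply' _ (measurableSet_singleton _).compl]
    norm_num
  · refine (measure_mono (Set.subset_compl_singleton_iff.mpr h)).trans ?_
    unfold signUnif
    simp only [Measure.coe_add, Measure.coe_smul, Pi.add_apply, Pi.smul_apply, smul_eq_mul]
    rw [Measure.dirac_apply' _ (measurableSet_singleton _).compl,
      Measure.dirac_apply' _ (measurableSet_singleton _).compl]
    norm_num

lemma tail_pi (n : ℕ) (T : ℝ) (hT : 0 < T) :
    stdGaussianPi n {x | ∃ i, T ≤ |x i|} ≤ ENNReal.ofReal (n * (1 / T ^ 2)) := by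
  have e : {x : Fin n → ℝ | ∃ i, T ≤ |x i|} = ⋃ i, (fun x => x i) ⁻¹' {t | T ≤ |t|} := by
    ext x; simp
  rw [e]
  refine (measure_iUnion_fintype_le _ _).trans ?_
  have : ∀ i : Fin n, stdGaussianPi n ((fun x => x i) ⁻¹' {t | T ≤ |t|}) ≤
      ENNReal.ofReal (1 / T ^ 2) := by
    intro i
    have hm : MeasurableSet {t : ℝ | T ≤ |t|} := measurableSet_le measurable_const measurable_id.abs
    have := (measurePreserving_eval (fun _ : Fin n => gaussianReal 0 1) i).measure_preimage
      hm.nullMeasurableSet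
    unfold stdGaussianPi
    exact this.le.trans (gauss_tail T hT)
  refine (Finset.sum_le_sum fun i _ => this i).trans ?_
  rw [Finset.sum_const, nsmul_eq_mul, ENNReal.ofReal_mul (by positivity), ENNReal.ofReal_natCast]
  simp

lemma continuous_polyEval {ι : Type*} (c : Multiset ι →₀ ℝ) : Continuous (polyEval c) := by
  unfold polyEval
  refine continuous_finsetSum _ fun S _ => ?_
  exact continuous_const.mul (continuous_multiset_prod S fun i _ => continuous_apply i)

lemma measurable_TdPoint (d n : ℕ) : Measurable (TdPoint d n) := by
  rw [measurable_pi_iff]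
  rintro (i | i)
  · unfold TdPoint
    simp only [Sum.elim_inl]
    have h1 : Measurable fun ω : (Fin n → Bool) × (Fin n → ℝ) × (Fin n → ℝ) × ℝ => ω.1 i := by
      fun_prop
    have hs : MeasurableSet {ω : (Fin n → Bool) × (Fin n → ℝ) × (Fin n → ℝ) × ℝ |
        ω.1 i = true} := h1 (measurableSet_singleton true)
    refine Measurable.add (Measurable.add (Measurable.ite hs ?_ measurable_const) ?_) ?_
    all_goals fun_prop
  · unfold TdPoint
    simp only [Sum.elim_inr]
    fun_prop

lemma measurable_sign' : Measurable Real.sign := by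
  unfold Real.sign
  refine Measurable.ite measurableSet_Iio measurable_const ?_
  exact Measurable.ite measurableSet_Ioi measurable_const measurable_const

/-- The substitution in the variables `h` for fixed `a`, `g`. -/
noncomputable def phiH {n : ℕ} (d : ℕ) (a : Fin n → Bool) (g : Fin n → ℝ) :
    Fin n ⊕ Fin n → MvPolynomial (Fin n) ℝ :=
  Sum.elim (fun i => MvPolynomial.C (if a i then 1 else 0) * MvPolynomial.X i +
    MvPolynomial.C (g i ^ d)) (fun i => MvPolynomial.C (g i))

lemma phiG_deg {n : ℕ} (d : ℕ) (hd : 1 ≤ d) (s : Fin n ⊕ Fin n) :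
    (phiG d s).totalDegree ≤ d := by
  rcases s with i | i
  · simp [phiG]
  · simpa [phiG] using hd

lemma phiH_deg {n : ℕ} (d : ℕ) (hd : 1 ≤ d) (a : Fin n → Bool) (g : Fin n → ℝ)
    (s : Fin n ⊕ Fin n) : (phiH d a g s).totalDegree ≤ d := by
  rcases s with i | i
  · simp only [phiH, Sum.elim_inl]
    refine (MvPolynomial.totalDegree_add _ _).trans (max_le ?_ ?_)
    · refine (MvPolynomial.totalDegree_mul _ _).trans ?_
      rw [MvPolynomial.totalDegree_C, MvPolynomial.totalDegree_X]
      simpa using hd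
    · rw [MvPolynomial.totalDegree_C]
      exact Nat.zero_le _
  · simp [phiH]

lemma eval_phiH {n : ℕ} (d : ℕ) (a : Fin n → Bool) (g h : Fin n → ℝ)
    (c : Multiset (Fin n ⊕ Fin n) →₀ ℝ) :
    MvPolynomial.eval h (polyMv (phiH d a g) c) = polyEval c (TdPoint d n (a, h, g, 0)) := by
  rw [eval_polyMv]
  congr 1
  funext s
  rcases s with i | i
  · by_cases ha : a i = true <;> simp [phiH, TdPoint, ha]
  · simp [phiH, TdPoint]

lemma coeff_phiH {n : ℕ} (d : ℕ) (a : Fin n → Bool) (g : Fin n → ℝ)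
    (c : Multiset (Fin n ⊕ Fin n) →₀ ℝ) :
    (polyMv (phiH d a g) c).coeff 0 = MvPolynomial.eval g (polyMv (phiG d) c) := by
  have e : (polyMv (phiH d a g) c).coeff 0 = MvPolynomial.eval 0 (polyMv (phiH d a g) c) := by
    rw [MvPolynomial.eval_zero, MvPolynomial.constantCoeff_eq]
  rw [e, eval_polyMv, eval_polyMv]
  congr 1
  funext s
  rcases s with i | i
  · by_cases ha : a i = true <;> simp [phiH, phiG, ha]
  · simp [phiH, phiG]

lemma sign_fixed {n : ℕ} (d : ℕ) (c : Multiset (Fin n ⊕ Fin n) →₀ ℝ)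
    (hc : ∀ S ∈ c.support, Multiset.card S ≤ d) (hw : weight c = 1)
    (a : Fin n → Bool) (g h : Fin n → ℝ) (hg : ∀ i, |g i| ≤ n) (hh : ∀ i, |h i| ≤ n) (ε : ℝ)
    (hε : d * (2 : ℝ) ^ (-((n : ℤ) ^ 2)) * ((n : ℝ) + (n : ℝ) ^ d + 1) ^ d < ε)
    (hbig : ε ≤ |polyEval c (TdPoint d n (a, h, g, 0))|) :
    signUnif {b | Real.sign (polyEval c (TdPoint d n (a, h, g, b))) = b} ≤
      ENNReal.ofReal (1 / 2) := by
  set δ : ℝ := (2 : ℝ) ^ (-((n : ℤ) ^ 2)) with hδ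
  have hδ0 : 0 ≤ δ := by positivity
  have hδ1 : δ ≤ 1 := by
    apply zpow_le_one_of_nonpos₀ (by norm_num)
    have := sq_nonneg (n : ℤ)
    omega
  have hn0 : (0 : ℝ) ≤ n := by positivity
  have hnd : (0 : ℝ) ≤ (n : ℝ) ^ d := by positivity
  set K : ℝ := (n : ℝ) + (n : ℝ) ^ d + 1 with hK
  have hbound : ∀ b : ℝ, |b| ≤ 1 → ∀ s, |TdPoint d n (a, h, g, b) s| ≤ K := by
    intro b hb s
    rcases s with i | i
    · simp only [TdPoint, Sum.elim_inl]
      have h1 : |(if a i = true then h i else 0)| ≤ n := by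
        split_ifs
        · exact hh i
        · simp
      have h2 : |g i ^ d| ≤ (n : ℝ) ^ d := by
        rw [abs_pow]
        exact pow_le_pow_left₀ (abs_nonneg _) (hg i) d
      have h3 : |b * δ| ≤ 1 := by
        rw [abs_mul, abs_of_nonneg hδ0]
        nlinarith [abs_nonneg b]
      exact (abs_add_three _ _ _).trans (by rw [hK]; linarith)
    · simp only [TdPoint, Sum.elim_inr]
      exact (hg i).trans (by rw [hK]; linarith)
  have hpert : ∀ b : ℝ, |b| ≤ 1 → |polyEval c (TdPoint d n (a, h, g, b)) -
      polyEval c (TdPoint d n (a, h, g, 0))| ≤ d * δ * K ^ d := by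
    intro b hb
    refine poly_perturb c d hc hw _ _ δ K hδ0 (by rw [hK]; linarith) (hbound b hb)
      (hbound 0 (by simp)) ?_
    intro s
    rcases s with i | i
    · simp only [TdPoint, Sum.elim_inl]
      rw [← hδ]
      have : (if a i = true then h i else 0) + g i ^ d + b * δ -
        ((if a i = true then h i else 0) + g i ^ d + 0 * δ) = b * δ := by ring
      rw [this, abs_mul, abs_of_nonneg hδ0]
      nlinarith [abs_nonneg b]
    · simp [TdPoint, hδ0]
  have hp1 := hpert 1 (by simp)
  have hp2 := hpert (-1) (by simp)
  rw [abs_le] at hp1 hp2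
  apply signUnif_le
  rcases le_abs.mp hbig with hpos | hneg
  · right
    intro hmem
    rw [Set.mem_ofPred_eq, Real.sign_of_pos (by linarith)] at hmem
    norm_num at hmem
  · left
    intro hmem
    rw [Set.mem_ofPred_eq, Real.sign_of_neg (by linarith)] at hmem
    norm_num at hmem

lemma pass_bound (d n : ℕ) (hd : 1 ≤ d) (hn : 1 ≤ n) (hβ0 : 0 ≤ 1 / Real.log n)
    (hβ1 : 1 / Real.log n ≤ 1)
    (c : Multiset (Fin n ⊕ Fin n) →₀ ℝ)
    (hc : ∀ S ∈ c.support, Multiset.card S ≤ d) (hw : weight c = 1)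
    (η : ℝ) (hη : 0 < η) (m : Fin n →₀ ℕ) (hm : η ≤ |(polyMv (phiG d) c).coeff m|)
    (hpar : d * (2 : ℝ) ^ (-((n : ℤ) ^ 2)) * ((n : ℝ) + (n : ℝ) ^ d + 1) ^ d <
      η * (((1 / (n : ℝ) ^ 2) ^ 2 / 4) ^ (d * d)) ^ n * (((1 / (n : ℝ) ^ 2) ^ 2 / 4) ^ (d * d)) ^ n) :
    TdMeasure n {ω | Real.sign (polyEval c (TdPoint d n ω)) = ω.2.2.2} ≤
      ENNReal.ofReal (1 / 2 + (2 * d * d + 4) / n) := by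
  have hnR : (1 : ℝ) ≤ n := by exact_mod_cast hn
  set τ : ℝ := 1 / (n : ℝ) ^ 2 with hτ
  have hτ0 : 0 < τ := by positivity
  have hτ1 : τ ≤ 1 := by
    rw [hτ, div_le_one (by positivity)]
    exact one_le_pow₀ hnR
  set θ : ℝ := (τ ^ 2 / 4) ^ (d * d) with hθ
  have hθ0 : 0 < θ := by positivity
  set ε := η * θ ^ n * θ ^ n with hε
  have hprob := bernoulliBool_prob _ hβ0 hβ1
  have hF : Measurable fun ω => polyEval c (TdPoint d n ω) :=
    (continuous_polyEval c).measurable.comp (measurable_TdPoint d n)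
  have hE : MeasurableSet {ω : (Fin n → Bool) × (Fin n → ℝ) × (Fin n → ℝ) × ℝ |
      Real.sign (polyEval c (TdPoint d n ω)) = ω.2.2.2} :=
    measurableSet_eq_fun (measurable_sign'.comp hF) (by fun_prop)
  have step : ∀ a : Fin n → Bool, ((stdGaussianPi n).prod ((stdGaussianPi n).prod signUnif))
      (Prod.mk a ⁻¹' {ω | Real.sign (polyEval c (TdPoint d n ω)) = ω.2.2.2}) ≤
        ENNReal.ofReal (1 / 2 + (2 * d * d + 4) / n) := by
    intro a
    have hEa := measurable_prodMk_left (x := a) hE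
    have hR := (measurePreserving_prodAssoc (stdGaussianPi n) (stdGaussianPi n) signUnif).comp
      ((Measure.measurePreserving_swap (μ := stdGaussianPi n) (ν := stdGaussianPi n)).prod
        (MeasurePreserving.id signUnif))
    rw [← hR.measure_preimage hEa.nullMeasurableSet]
    have hB1m : MeasurableSet {p : (Fin n → ℝ) × (Fin n → ℝ) |
        |polyEval c (TdPoint d n (a, p.2, p.1, 0))| < ε} := by
      refine measurableSet_lt (Measurable.abs ?_) measurable_const
      exact hF.comp (by fun_prop)
    have htm : MeasurableSet {x : Fin n → ℝ | ∃ i, (n : ℝ) ≤ |x i|} := by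
      have e : {x : Fin n → ℝ | ∃ i, (n : ℝ) ≤ |x i|} = ⋃ i, {x | (n : ℝ) ≤ |x i|} := by
        ext x; simp
      rw [e]
      exact MeasurableSet.iUnion fun i =>
        measurableSet_le measurable_const (measurable_pi_apply i).abs
    have hB1 : ((stdGaussianPi n).prod (stdGaussianPi n)) {p : (Fin n → ℝ) × (Fin n → ℝ) |
        |polyEval c (TdPoint d n (a, p.2, p.1, 0))| < ε} ≤
        ENNReal.ofReal (n * (((d * d : ℕ) + 1) * τ)) +
        ENNReal.ofReal (n * (((d * d : ℕ) + 1) * τ)) := by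
      refine prod_bound _ _ _ hB1m _ _ _ (multi_anti (d * d) η τ hη hτ0 hτ1 n
        (polyMv (phiG d) c) m (degreeOf_polyMv _ c d hc (phiG_deg d hd)) hm) ?_
      intro g hg
      rw [Set.mem_ofPred_eq, not_lt] at hg
      have := multi_anti (d * d) (η * θ ^ n) τ (by positivity) hτ0 hτ1 n
        (polyMv (phiH d a g) c) 0 (degreeOf_polyMv _ c d hc (phiH_deg d hd a g))
        (by rw [coeff_phiH]; exact hg)
      refine le_trans (measure_mono ?_) this
      intro h hh
      rw [Set.mem_ofPred_eq, eval_phiH]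
      exact hh
    have hB2 : ((stdGaussianPi n).prod (stdGaussianPi n))
        (Prod.fst ⁻¹' {x : Fin n → ℝ | ∃ i, (n : ℝ) ≤ |x i|}) ≤
        ENNReal.ofReal (n * (1 / (n : ℝ) ^ 2)) := by
      rw [measurePreserving_fst.measure_preimage htm.nullMeasurableSet]
      exact tail_pi n n (by linarith)
    have hB3 : ((stdGaussianPi n).prod (stdGaussianPi n))
        (Prod.snd ⁻¹' {x : Fin n → ℝ | ∃ i, (n : ℝ) ≤ |x i|}) ≤
        ENNReal.ofReal (n * (1 / (n : ℝ) ^ 2)) := by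
      rw [measurePreserving_snd.measure_preimage htm.nullMeasurableSet]
      exact tail_pi n n (by linarith)
    refine (prod_bound _ _ _ (hR.measurable hEa) _ _ (ENNReal.ofReal (1 / 2))
      ((measure_union_le _ _).trans (add_le_add ((measure_union_le _ _).trans
        (add_le_add hB1 hB2)) hB3)) ?_).trans ?_
    · rintro ⟨g, h⟩ hgh
      simp only [Set.mem_union, Set.mem_ofPred_eq, Set.mem_preimage, not_or, not_lt, not_exists,
        not_le] at hgh
      obtain ⟨⟨h1, h2⟩, h3⟩ := hgh
      exact sign_fixed d c hc hw a g h (fun i => (h2 i).le) (fun i => (h3 i).le) ε hpar h1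
    · rw [← ENNReal.ofReal_add (by positivity) (by positivity),
        ← ENNReal.ofReal_add (by positivity) (by positivity),
        ← ENNReal.ofReal_add (by positivity) (by positivity),
        ← ENNReal.ofReal_add (by positivity) (by positivity)]
      apply ENNReal.ofReal_le_ofReal
      apply le_of_eq
      rw [hτ]
      push_cast
      field_simp
      ring
  have := prod_bound (Measure.pi fun _ : Fin n => bernoulliBool (1 / Real.log n))
    ((stdGaussianPi n).prod ((stdGaussianPi n).prod signUnif)) _ hE ∅ 0 _ (by simp)
    (fun a _ => step a)
  rw [zero_add] at this
  exact this

lemma param_bound (d : ℕ) (hd : 1 ≤ d) : ∀ᶠ n : ℕ in Filter.atTop,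
    d * (2 : ℝ) ^ (-((n : ℤ) ^ 2)) * ((n : ℝ) + (n : ℝ) ^ d + 1) ^ d <
      (n : ℝ) ^ (-(10 * d : ℤ)) * (((1 / (n : ℝ) ^ 2) ^ 2 / 4) ^ (d * d)) ^ n *
        (((1 / (n : ℝ) ^ 2) ^ 2 / 4) ^ (d * d)) ^ n := by
  set C : ℕ := 1 + (d + 1) * d + 10 * d + 12 * (d * d) with hC
  have hlim := tendsto_pow_const_div_const_pow_of_one_lt C (r := (2 : ℝ)) (by norm_num)
  filter_upwards [hlim.eventually (gt_mem_nhds one_pos), Filter.eventually_ge_atTop 3,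
    Filter.eventually_ge_atTop d] with n h1 h3 hnd
  have hN : (3 : ℝ) ≤ n := by exact_mod_cast h3
  have hdn : (d : ℝ) ≤ n := by exact_mod_cast hnd
  set N : ℝ := (n : ℝ) with hNdef
  have hN0 : 0 < N := by linarith
  have hN1 : 1 ≤ N := by linarith
  rw [div_lt_one (by positivity)] at h1
  have h2 : (N ^ C) ^ n < (2 ^ n) ^ n := pow_lt_pow_left₀ h1 (by positivity) (by omega)
  have e2 : (2 : ℝ) ^ (-((n : ℤ) ^ 2)) = ((2 ^ n) ^ n)⁻¹ := by
    rw [zpow_neg, ← pow_mul, ← sq]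
    norm_cast
  have e3 : N ^ (-(10 * d : ℤ)) = (N ^ (10 * d))⁻¹ := by
    rw [zpow_neg]
    norm_cast
  rw [e2, e3]
  have hθ : (N ^ 6)⁻¹ ≤ (1 / N ^ 2) ^ 2 / 4 := by
    have : (1 / N ^ 2) ^ 2 / 4 = (4 * N ^ 4)⁻¹ := by field_simp
    rw [this]
    apply inv_anti₀ (by positivity)
    have : N ^ 6 = N ^ 2 * N ^ 4 := by ring
    rw [this]
    gcongr
    nlinarith
  have hθn : (N ^ (6 * (d * d) * n))⁻¹ ≤ (((1 / N ^ 2) ^ 2 / 4) ^ (d * d)) ^ n := by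
    rw [pow_mul, pow_mul, ← inv_pow, ← inv_pow]
    gcongr
  have hK : N + N ^ d + 1 ≤ N ^ (d + 1) := by
    have h5 : N ≤ N ^ d := le_self_pow₀ hN1 (by omega)
    rw [pow_succ]
    nlinarith
  have hL : d * ((2 ^ n) ^ n : ℝ)⁻¹ * (N + N ^ d + 1) ^ d ≤
      N ^ (1 + (d + 1) * d) * ((2 ^ n) ^ n : ℝ)⁻¹ := by
    rw [pow_add, pow_one, pow_mul]
    calc _ ≤ N * ((2 ^ n) ^ n : ℝ)⁻¹ * (N ^ (d + 1)) ^ d := by gcongr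
      _ = _ := by ring
  have hRr : (N ^ (10 * d))⁻¹ * (N ^ (6 * (d * d) * n))⁻¹ * (N ^ (6 * (d * d) * n))⁻¹ ≤
      (N ^ (10 * d))⁻¹ * (((1 / N ^ 2) ^ 2 / 4) ^ (d * d)) ^ n *
        (((1 / N ^ 2) ^ 2 / 4) ^ (d * d)) ^ n := by gcongr
  refine hL.trans_lt (lt_of_lt_of_le ?_ hRr)
  rw [← mul_inv, ← mul_inv, ← pow_add, ← pow_add, ← div_eq_mul_inv, div_lt_iff₀ (by positivity),
    inv_mul_eq_div, lt_div_iff₀ (by positivity), ← pow_add]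
  refine lt_of_le_of_lt ?_ h2
  rw [← pow_mul]
  apply pow_le_pow_right₀ hN1
  rw [hC]
  have : 1 ≤ n := by omega
  nlinarith [Nat.zero_le ((1 + (d + 1) * d + 10 * d) * (n - 1)),
    Nat.mul_le_mul_left (1 + (d + 1) * d + 10 * d) this]

lemma log_bound (C : ℝ) (hC : 0 < C) : ∀ᶠ n : ℕ in Filter.atTop,
    C / n < 1 / Real.log n ∧ 1 / Real.log n ≤ 1 := by
  have h := (Real.isLittleO_log_id_atTop.comp_tendsto tendsto_natCast_atTop_atTop).def
    (show 0 < 1 / (2 * C) by positivity)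
  have h2 := (Real.tendsto_log_atTop.comp tendsto_natCast_atTop_atTop).eventually_ge_atTop 1
  filter_upwards [h, h2, Filter.eventually_ge_atTop 1] with n h h2 h3
  simp only [Function.comp, id, Real.norm_eq_abs] at h h2
  have hn : (1 : ℝ) ≤ n := by exact_mod_cast h3
  rw [abs_of_pos (by linarith), abs_of_pos (by linarith)] at h
  constructor
  · rw [div_lt_div_iff₀ (by linarith) (by linarith)]
    have : C * Real.log n ≤ C * (1 / (2 * C) * n) := by gcongr
    have e : C * (1 / (2 * C) * n) = n / 2 := by field_simp
    linarith
  · rw [div_le_one (by linarith)]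
    exact h2

lemma weight_split {n : ℕ} (c : Multiset (Fin n ⊕ Fin n) →₀ ℝ) :
    weight c = weightLeft c + weightRight c + weightCross c := by
  unfold weight weightLeft weightRight weightCross
  rw [← Finset.sum_add_distrib, ← Finset.sum_add_distrib]
  refine Finset.sum_congr rfl fun S _ => ?_
  by_cases h0 : S = 0
  · subst h0; simp
  · obtain ⟨x, hx⟩ := Multiset.exists_mem_of_ne_zero h0
    by_cases hl : ∀ x ∈ S, x.isLeft = true
    · have h1 : ¬ ∀ x ∈ S, x.isRight = true := fun h => by
        have a1 := hl x hx
        have a2 := h x hx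
        cases x <;> simp at a1 a2
      have h2 : ¬ ∃ x ∈ S, x.isRight = true := by
        rintro ⟨y, hy, hy'⟩
        have a1 := hl y hy
        cases y <;> simp at a1 hy'
      rw [if_neg h0, if_pos ⟨h0, hl⟩, if_neg (fun h => h1 h.2), if_neg (fun h => h2 h.2)]
      ring
    · have hex : ∃ x ∈ S, x.isRight = true := by
        push Not at hl
        obtain ⟨y, hy, hy'⟩ := hl
        exact ⟨y, hy, by cases y <;> simp_all⟩
      by_cases hr : ∀ x ∈ S, x.isRight = true
      · have h2 : ¬ ∃ x ∈ S, x.isLeft = true := by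
          rintro ⟨y, hy, hy'⟩
          have a1 := hr y hy
          cases y <;> simp at a1 hy'
        rw [if_neg h0, if_neg (fun h => hl h.2), if_pos ⟨h0, hr⟩, if_neg (fun h => h2 h.1)]
        ring
      · have hex' : ∃ x ∈ S, x.isLeft = true := by
          push Not at hr
          obtain ⟨y, hy, hy'⟩ := hr
          exact ⟨y, hy, by cases y <;> simp_all⟩
        rw [if_neg h0, if_neg (fun h => hl h.2), if_neg (fun h => hr h.2), if_pos ⟨hex', hex⟩]
        ring

lemma finish (d n : ℕ) (hd : 1 ≤ d) (hn : 100 ≤ n) (c : Multiset (Fin n ⊕ Fin n) →₀ ℝ)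
    (hc : ∀ S ∈ c.support, Multiset.card S ≤ d) (hw : weight c = 1)
    (hcoef : ∀ m, |(polyMv (phiG d) c).coeff m| ≤ (n : ℝ) ^ (-(10 * d : ℤ))) :
      ((∀ S : Multiset (Fin n ⊕ Fin n), (∀ x ∈ S, x.isLeft = true) →
          2 ≤ Multiset.card S → |c S| ≤ (n : ℝ) ^ (-(10 * d : ℤ))) ∧
        (∀ S : Multiset (Fin n ⊕ Fin n), (∀ x ∈ S, x.isRight = true) →
          (∀ i : Fin n, S ≠ Multiset.replicate d (Sum.inr i)) →
          |c S| ≤ (n : ℝ) ^ (-(10 * d : ℤ))) ∧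
        (∀ i : Fin n,
          |c {Sum.inl i} + c (Multiset.replicate d (Sum.inr i))| ≤
            (n : ℝ) ^ (-(10 * d : ℤ))) ∧
        (∀ S : Multiset (Fin n ⊕ Fin n), (∃ x ∈ S, x.isLeft = true) →
          (∃ x ∈ S, x.isRight = true) → |c S| ≤ (n : ℝ) ^ (-(10 * d : ℤ)))) ∧
      weightCross c ≤ 1 / n ∧
      |weightLeft c - weightRight c| ≤ 1 / n ∧
      0.49 ≤ weightLeft c ∧ weightLeft c ≤ 0.51 ∧
      0.49 ≤ weightRight c ∧ weightRight c ≤ 0.51 := by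
  set η : ℝ := (n : ℝ) ^ (-(10 * d : ℤ)) with hη
  have hnR : (100 : ℝ) ≤ n := by exact_mod_cast hn
  have hη0 : 0 ≤ η := by positivity
  have gen : ∀ S : Multiset (Fin n ⊕ Fin n), (∀ i, S ≠ {Sum.inl i}) →
      (∀ i, S ≠ Multiset.replicate d (Sum.inr i)) → |c S| ≤ η := by
    intro S h1 h2
    by_cases hS : Multiset.card S ≤ d
    · rw [← coeff_polyG_single d hd c hc S hS h1 h2]
      exact hcoef _
    · have : c S = 0 := by
        by_contra h
        exact hS (hc S (Finsupp.mem_support_iff.mpr h))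
      rw [this]; simpa using hη0
  have hi : ∀ S : Multiset (Fin n ⊕ Fin n), (∀ x ∈ S, x.isLeft = true) →
      2 ≤ Multiset.card S → |c S| ≤ η := by
    intro S hl h2
    apply gen
    · rintro i rfl
      simp at h2
    · rintro i rfl
      have := hl (Sum.inr i) (Multiset.mem_replicate.mpr ⟨by omega, rfl⟩)
      simp at this
  have hii : ∀ S : Multiset (Fin n ⊕ Fin n), (∀ x ∈ S, x.isRight = true) →
      (∀ i : Fin n, S ≠ Multiset.replicate d (Sum.inr i)) → |c S| ≤ η := by
    intro S hr h2
    apply gen _ _ h2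
    rintro i rfl
    have := hr (Sum.inl i) (by simp)
    simp at this
  have hiii : ∀ i : Fin n, |c {Sum.inl i} + c (Multiset.replicate d (Sum.inr i))| ≤ η := by
    intro i
    rw [← coeff_polyG_pair d hd c hc i]
    exact hcoef _
  have hiv : ∀ S : Multiset (Fin n ⊕ Fin n), (∃ x ∈ S, x.isLeft = true) →
      (∃ x ∈ S, x.isRight = true) → |c S| ≤ η := by
    rintro S ⟨x, hx, hx'⟩ ⟨y, hy, hy'⟩
    apply gen
    · rintro i rfl
      rw [Multiset.mem_singleton] at hy
      rw [hy] at hy'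
      simp at hy'
    · rintro i rfl
      rw [Multiset.eq_of_mem_replicate hx] at hx'
      simp at hx'
  refine ⟨⟨hi, hii, hiii, hiv⟩, ?_⟩
  have hcard : (c.support.card : ℝ) ≤ (n : ℝ) ^ (2 * d) := by
    have h1 := card_support_le c d hc
    have h2 : (Fintype.card (Fin n ⊕ Fin n) + 1) ^ d ≤ n ^ (2 * d) := by
      rw [pow_mul]
      apply Nat.pow_le_pow_left
      simp only [Fintype.card_sum, Fintype.card_fin]
      nlinarith
    exact_mod_cast h1.trans h2
  have e3 : η = ((n : ℝ) ^ (10 * d))⁻¹ := by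
    rw [hη, zpow_neg]
    norm_cast
  have hsmall : ∀ k, k ≤ 2 * d → (n : ℝ) ^ k * η ≤ 1 / (n : ℝ) ^ 2 := by
    intro k hk
    rw [e3, ← div_eq_mul_inv, div_le_div_iff₀ (by positivity) (by positivity), one_mul, ← pow_add]
    exact pow_le_pow_right₀ (by linarith) (by omega)
  have hNη : c.support.card * η ≤ 1 / (n : ℝ) ^ 2 :=
    (mul_le_mul_of_nonneg_right hcard hη0).trans (hsmall _ le_rfl)
  have hnη : n * η ≤ 1 / (n : ℝ) ^ 2 := by
    have := hsmall 1 (by omega)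
    rwa [pow_one] at this
  have hn2 : 1 / (n : ℝ) ^ 2 + 1 / (n : ℝ) ^ 2 ≤ 1 / n := by
    rw [← add_div, div_le_div_iff₀ (by positivity) (by positivity)]
    nlinarith
  have hn2' : 0 ≤ 1 / (n : ℝ) ^ 2 := by positivity
  have h100 : 1 / (n : ℝ) ≤ 1 / 100 := by
    apply one_div_le_one_div_of_le (by norm_num) hnR
  have hX := (sum_split_bound (n := 0) c (fun S => (∃ x ∈ S, x.isLeft = true) ∧
    ∃ x ∈ S, x.isRight = true) (fun i => i.elim0) (fun i => i.elim0) (fun i => i.elim0) η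
    (fun S h _ => hiv S h.1 h.2) hη0)
  have hXL := (sum_split_bound c (fun S => S ≠ 0 ∧ ∀ x ∈ S, x.isLeft = true)
    (fun i : Fin n => {Sum.inl i}) (fun i j h => by simpa using h) (fun i => by simp) η
    (fun S h h' => by
      apply hi S h.2
      by_contra hlt
      have hpos : 0 < Multiset.card S := Multiset.card_pos.mpr h.1
      obtain ⟨x, hx⟩ := Multiset.card_eq_one.mp (show Multiset.card S = 1 by omega)
      have hxl := h.2 x (by rw [hx]; simp)
      rcases x with i | i
      · exact h' i hx
      · simp at hxl) hη0)
  have hXR := (sum_split_bound c (fun S => S ≠ 0 ∧ ∀ x ∈ S, x.isRight = true)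
    (fun i : Fin n => Multiset.replicate d (Sum.inr i))
    (fun i j h => by
      have : (Sum.inr i : Fin n ⊕ Fin n) ∈ Multiset.replicate d (Sum.inr j) := by
        rw [← (show Multiset.replicate d (Sum.inr i : Fin n ⊕ Fin n) =
          Multiset.replicate d (Sum.inr j) from h)]
        exact Multiset.mem_replicate.mpr ⟨by omega, rfl⟩
      simpa using Multiset.eq_of_mem_replicate this)
    (fun i => by
      refine ⟨?_, ?_⟩
      · intro h
        have := congrArg Multiset.card h
        simp at this
        omega
      · intro x hx
        rw [Multiset.eq_of_mem_replicate hx]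
        rfl) η
    (fun S h h' => hii S h.2 h') hη0)
  have hcross : weightCross c ≤ 1 / (n : ℝ) ^ 2 := by
    have := hX.2
    rw [Finset.univ_eq_empty, Finset.sum_empty, zero_add] at this
    exact this.trans hNη
  have hcross0 : 0 ≤ weightCross c := by
    unfold weightCross
    refine Finset.sum_nonneg fun S _ => ?_
    split_ifs <;> positivity
  set W1 := ∑ i : Fin n, |c {Sum.inl i}|
  set W2 := ∑ i : Fin n, |c (Multiset.replicate d (Sum.inr i))|
  have hL1 : W1 ≤ weightLeft c := hXL.1
  have hL2 : weightLeft c ≤ W1 + c.support.card * η := hXL.2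
  have hR1 : W2 ≤ weightRight c := hXR.1
  have hR2 : weightRight c ≤ W2 + c.support.card * η := hXR.2
  have hW : |W1 - W2| ≤ n * η := by
    have e : (n : ℝ) * η = ∑ i : Fin n, η := by simp
    rw [e, ← Finset.sum_sub_distrib]
    refine (Finset.abs_sum_le_sum_abs _ _).trans (Finset.sum_le_sum fun i _ => ?_)
    refine le_trans ?_ (hiii i)
    have := abs_abs_sub_abs_le_abs_sub (c {Sum.inl i}) (-c (Multiset.replicate d (Sum.inr i)))
    rwa [abs_neg, sub_neg_eq_add] at this
  rw [abs_le] at hW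
  have hsum := weight_split c
  rw [hw] at hsum
  have hdiff : |weightLeft c - weightRight c| ≤ 1 / n := by
    rw [abs_le]
    constructor <;> linarith [hW.1, hW.2]
  refine ⟨by linarith, hdiff, ?_⟩
  rw [abs_le] at hdiff
  obtain ⟨hd1, hd2⟩ := hdiff
  refine ⟨?_, ?_, ?_, ?_⟩ <;> norm_num <;> linarith

/-- The structure of the coefficients of a degree-`d` polynomial of weight `1`
passing the dictator test `T_d` with probability at least `1/2 + β`
(`β = 1/log n`), for sufficiently large `n`: bounds (i)-(iv) on individual
coefficients, and the consequent bounds on the weights of `f₁`, `f₂`, `f₁₂`. -/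
theorem stmt5 (d : ℕ) (hd : 1 ≤ d) :
    ∃ N : ℕ, ∀ n ≥ N, ∀ c : Multiset (Fin n ⊕ Fin n) →₀ ℝ,
      (∀ S ∈ c.support, Multiset.card S ≤ d) →
      weight c = 1 →
      ENNReal.ofReal (1 / 2 + 1 / Real.log n) ≤
        TdMeasure n {ω | Real.sign (polyEval c (TdPoint d n ω)) = ω.2.2.2} →
      ((∀ S : Multiset (Fin n ⊕ Fin n), (∀ x ∈ S, x.isLeft = true) →
          2 ≤ Multiset.card S → |c S| ≤ (n : ℝ) ^ (-(10 * d : ℤ))) ∧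
        (∀ S : Multiset (Fin n ⊕ Fin n), (∀ x ∈ S, x.isRight = true) →
          (∀ i : Fin n, S ≠ Multiset.replicate d (Sum.inr i)) →
          |c S| ≤ (n : ℝ) ^ (-(10 * d : ℤ))) ∧
        (∀ i : Fin n,
          |c {Sum.inl i} + c (Multiset.replicate d (Sum.inr i))| ≤
            (n : ℝ) ^ (-(10 * d : ℤ))) ∧
        (∀ S : Multiset (Fin n ⊕ Fin n), (∃ x ∈ S, x.isLeft = true) →
          (∃ x ∈ S, x.isRight = true) → |c S| ≤ (n : ℝ) ^ (-(10 * d : ℤ)))) ∧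
      weightCross c ≤ 1 / n ∧
      |weightLeft c - weightRight c| ≤ 1 / n ∧
      0.49 ≤ weightLeft c ∧ weightLeft c ≤ 0.51 ∧
      0.49 ≤ weightRight c ∧ weightRight c ≤ 0.51 := by
  have hlog := log_bound (2 * d * d + 4) (by positivity)
  obtain ⟨N, hN⟩ := Filter.eventually_atTop.mp ((param_bound d hd).and
    (hlog.and (Filter.eventually_ge_atTop 100)))
  refine ⟨N, fun n hn c hc hw hpass => ?_⟩
  obtain ⟨hpar, ⟨hl1, hl2⟩, h100⟩ := hN n hn
  apply finish d n hd h100 c hc hw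
  intro m
  by_contra hcon
  push Not at hcon
  have hnpos : (0 : ℝ) < n := by
    have : 0 < n := by omega
    exact_mod_cast this
  have hp : 0 ≤ (2 * d * d + 4 : ℝ) / n := by positivity
  have := pass_bound d n hd (by omega) (by linarith) hl2 c hc hw _ (by positivity) m hcon.le hpar
  have h2 := hpass.trans this
  rw [ENNReal.ofReal_le_ofReal_iff (by positivity)] at h2
  linarith
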